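/- arXiv:hep-th/0004163 — 3 statements merged into one kernel-verified Lean document; each statement's English description precedes it below -/
import Mathlib

section
/- Fix s ∈ ℝ and let d : (0,∞) × (0,∞) → ℂ satisfy the mass-dependent cocycle identity (with exponent s). Define p : (0,∞) → ℂ by p(m) := m^{−s} · d(m, m). Then for all λ, m > 0 one has d(λ, m) = λ^s · p(m) − p(λ⁻¹ m). In particular, every solution of the mass-dependent cocycle identity is a coboundary. -/
/-- Every solution of the mass-dependent cocycle identity
`d(λλ′, m) = d(λ′, λ⁻¹m) + (λ′)^s d(λ, m)` (with exponent `s`) is a coboundary: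
with `p(m) := m^{−s} d(m, m)` one has `d(λ, m) = λ^s p(m) − p(λ⁻¹m)`. -/
theorem massive_cocycle_is_coboundary (s : ℝ) (d : ℝ → ℝ → ℂ)
    (hcoc : ∀ a b m : ℝ, 0 < a → 0 < b → 0 < m →
      d (a * b) m = d b (a⁻¹ * m) + ((b ^ s : ℝ) : ℂ) * d a m) :
    ∀ a m : ℝ, 0 < a → 0 < m →
      d a m = ((a ^ s : ℝ) : ℂ) * (((m ^ (-s) : ℝ) : ℂ) * d m m) -
        (((( a⁻¹ * m) ^ (-s) : ℝ) : ℂ) * d (a⁻¹ * m) (a⁻¹ * m)) := by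
  intro a m ha hm
  have hb : 0 < a⁻¹ * m := by positivity
  have h := hcoc a (a⁻¹ * m) m ha hb hm
  rw [mul_inv_cancel_left₀ ha.ne'] at h
  have h1 : a ^ s * m ^ (-s) = (a⁻¹ * m) ^ (-s) := by
    rw [Real.mul_rpow (by positivity) hm.le, Real.inv_rpow ha.le, Real.rpow_neg ha.le, inv_inv]
  have h2 : (a⁻¹ * m) ^ (-s) * (a⁻¹ * m) ^ s = 1 := by
    rw [← Real.rpow_add hb]; simp
  have h1c : ((a ^ s : ℝ) : ℂ) * ((m ^ (-s) : ℝ) : ℂ) = (((a⁻¹ * m) ^ (-s) : ℝ) : ℂ) := by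
    rw [← h1, Complex.ofReal_mul]
  have h2c : (((a⁻¹ * m) ^ (-s) : ℝ) : ℂ) * (((a⁻¹ * m) ^ s : ℝ) : ℂ) = 1 := by
    rw [← Complex.ofReal_mul, h2, Complex.ofReal_one]
  rw [← mul_assoc, h1c, h]
  linear_combination (-(d a m)) * h2c
end

section
/- Fix s ∈ ℝ with s ≠ 0, and let d : (0,∞) → ℂ be differentiable and satisfy the massless cocycle identity (with exponent s). Then d(λ) = (d′(1)/s) · (λ^s − 1) for all λ > 0. -/
/-- If `d : (0,∞) → ℂ` is differentiable and satisfies the massless cocycle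
identity `d(λλ′) = d(λ′) + (λ′)^s d(λ)` with exponent `s ≠ 0`, then
`d(λ) = (d′(1)/s) (λ^s − 1)` for all `λ > 0`. -/
theorem massless_cocycle_sol_of_ne_zero (s : ℝ) (hs : s ≠ 0) (d : ℝ → ℂ)
    (hdiff : ∀ x : ℝ, 0 < x → DifferentiableAt ℝ d x)
    (hcoc : ∀ a b : ℝ, 0 < a → 0 < b →
      d (a * b) = d b + ((b ^ s : ℝ) : ℂ) * d a) :
    ∀ a : ℝ, 0 < a →
      d a = (deriv d 1 / (s : ℂ)) * (((a ^ s : ℝ) : ℂ) - 1) := by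
  have h2 : (((2:ℝ) ^ s : ℝ) : ℂ) - 1 ≠ 0 := by
    intro h
    have h1 : ((2:ℝ) ^ s) = 1 := by
      have := sub_eq_zero.mp h
      exact_mod_cast this
    have h3 := congrArg Real.log h1
    rw [Real.log_rpow (by norm_num), Real.log_one] at h3
    rcases mul_eq_zero.mp h3 with h | h
    · exact hs h
    · exact (Real.log_pos (by norm_num : (1:ℝ) < 2)).ne' h
  obtain ⟨c, hc⟩ : ∃ c : ℂ, ∀ a : ℝ, 0 < a → d a = c * (((a ^ s : ℝ) : ℂ) - 1) := by
    refine ⟨d 2 / ((((2:ℝ) ^ s : ℝ) : ℂ) - 1), fun a ha => ?_⟩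
    have e1 := hcoc a 2 ha (by norm_num)
    have e2 := hcoc 2 a (by norm_num) ha
    rw [mul_comm, e2] at e1
    rw [div_mul_eq_mul_div, eq_div_iff h2]
    linear_combination -e1
  have hd : HasDerivAt d (c * (s : ℂ)) 1 := by
    have h1 : HasDerivAt (fun x : ℝ => x ^ s) s 1 := by
      simpa using Real.hasDerivAt_rpow_const (x := 1) (p := s) (Or.inl one_ne_zero)
    have h3 : HasDerivAt (fun x : ℝ => c * (((x ^ s : ℝ) : ℂ) - 1)) (c * (s : ℂ)) 1 :=
      (h1.ofReal_comp.sub_const 1).const_mul c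
    refine h3.congr_of_eventuallyEq ?_
    filter_upwards [lt_mem_nhds (zero_lt_one (α := ℝ))] with x hx using hc x hx
  intro a ha
  have hs' : (s : ℂ) ≠ 0 := by exact_mod_cast hs
  rw [hd.deriv, mul_div_cancel_right₀ _ hs']
  exact hc a ha
end

section
/- Fix s ∈ ℝ, an integer t ≥ 1, and let d : (0,∞) × (ℝ^t \ {0}) → ℂ satisfy d(λλ′, 𝐦) = d(λ′, λ⁻¹𝐦) + (λ′)^s · d(λ, 𝐦) for all λ, λ′ > 0 and all 𝐦 ∈ ℝ^t with 𝐦 ≠ 0, where λ⁻¹𝐦 denotes the scalar multiple. Define P : ℝ^t \ {0} → ℂ by P(𝐦) := ‖𝐦‖^{−s} · d(‖𝐦‖, 𝐦), with ‖𝐦‖ the Euclidean norm. Then for all λ > 0 and 𝐦 ≠ 0 one has d(λ, 𝐦) = λ^s · P(𝐦) − P(λ⁻¹𝐦); that is, every solution is a coboundary. -/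
/-- The multi-mass version of the mass-dependent cocycle identity: if
`d(λλ′, 𝐦) = d(λ′, λ⁻¹𝐦) + (λ′)^s d(λ, 𝐦)` for all `λ, λ′ > 0` and all
`𝐦 ∈ ℝ^t \ {0}`, then with `P(𝐦) := ‖𝐦‖^{−s} d(‖𝐦‖, 𝐦)` one has
`d(λ, 𝐦) = λ^s P(𝐦) − P(λ⁻¹𝐦)`: every solution is a coboundary. -/
theorem multimass_cocycle_is_coboundary (s : ℝ) (t : ℕ) (ht : 1 ≤ t)
    (d : ℝ → EuclideanSpace ℝ (Fin t) → ℂ)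
    (hcoc : ∀ a b : ℝ, 0 < a → 0 < b → ∀ m : EuclideanSpace ℝ (Fin t), m ≠ 0 →
      d (a * b) m = d b (a⁻¹ • m) + ((b ^ s : ℝ) : ℂ) * d a m) :
    ∀ a : ℝ, 0 < a → ∀ m : EuclideanSpace ℝ (Fin t), m ≠ 0 →
      d a m = ((a ^ s : ℝ) : ℂ) * (((‖m‖ ^ (-s) : ℝ) : ℂ) * d ‖m‖ m) -
        (((‖a⁻¹ • m‖ ^ (-s) : ℝ) : ℂ) * d ‖a⁻¹ • m‖ (a⁻¹ • m)) := by
  intro a ha m hm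
  have hr : 0 < ‖m‖ := norm_pos_iff.mpr hm
  have hn : ‖a⁻¹ • m‖ = a⁻¹ * ‖m‖ := by
    rw [norm_smul, Real.norm_of_nonneg (inv_pos.mpr ha).le]
  have hb : 0 < a⁻¹ * ‖m‖ := mul_pos (inv_pos.mpr ha) hr
  have h := hcoc a (a⁻¹ * ‖m‖) ha hb m hm
  rw [mul_inv_cancel_left₀ ha.ne'] at h
  have e1 : a ^ s * ‖m‖ ^ (-s) = (a⁻¹ * ‖m‖) ^ (-s) := by
    rw [Real.mul_rpow (inv_pos.mpr ha).le hr.le, Real.inv_rpow ha.le, Real.rpow_neg ha.le, inv_inv]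
  have e2 : (a⁻¹ * ‖m‖) ^ (-s) * (a⁻¹ * ‖m‖) ^ s = 1 := by
    rw [← Real.rpow_add hb, neg_add_cancel, Real.rpow_zero]
  have e2' : (((a⁻¹ * ‖m‖) ^ (-s) : ℝ) : ℂ) * (((a⁻¹ * ‖m‖) ^ s : ℝ) : ℂ) = 1 := by
    exact_mod_cast e2
  rw [hn, ← mul_assoc, ← Complex.ofReal_mul, e1, h]
  linear_combination (-(d a m)) * e2'
end
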